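/- For every constant ε > 0, a single agent with at most O((log n)^{1−ε}) bits of memory needs at least Ω(log log n) pebbles to explore every connected graph on at most n vertices. Concretely: for every ε with 0 < ε < 1 and every constant c ∈ ℕ there is a constant c' > 0 such that for all sufficiently large n, if an agent with at most 2^{c·(log n)^{1−ε}} states and p distinguishable pebbles explores every connected graph on at most n vertices, then p ≥ c'·log log n. -/

import Mathlib

noncomputable section
open scoped Classical

/-- An undirected graph with locally labeled ports: vertex `v` has degree `deg v`,
and for a port `i < deg v`, `nbr v i` is the other endpoint of the edge with port
number `i` at `v`, while `back v i` is the port number of this edge at the other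
endpoint. -/
structure PGraph (V : Type) where
  deg : V → ℕ
  nbr : V → ℕ → V
  back : V → ℕ → ℕ

namespace PGraph

variable {V : Type}

/-- Well-formedness: positive degrees, ports of an edge match up at both
endpoints, no self-loops and no parallel edges. -/
def Wf (G : PGraph V) : Prop :=
  (∀ v, 0 < G.deg v) ∧
  (∀ v i, i < G.deg v → G.back v i < G.deg (G.nbr v i)) ∧
  (∀ v i, i < G.deg v → G.nbr (G.nbr v i) (G.back v i) = v) ∧
  (∀ v i, i < G.deg v → G.back (G.nbr v i) (G.back v i) = i) ∧
  (∀ v i, i < G.deg v → G.nbr v i ≠ v) ∧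
  (∀ v, Set.InjOn (G.nbr v) (Set.Iio (G.deg v)))

/-- Connectivity of a port-labeled graph. -/
def Conn (G : PGraph V) : Prop :=
  ∀ a b : V, Relation.ReflTransGen (fun x y => ∃ i, i < G.deg x ∧ G.nbr x i = y) a b

end PGraph

/-- A finite automaton agent with `s` states and a set of `p` distinguishable
pebbles.  The transition function maps (current state, degree of the current
vertex, port number of the edge through which the vertex was entered, set of
carried pebbles, set of pebbles located at the current vertex) to
(new state, move (`none` = stay at the vertex), new set of carried pebbles,
new set of pebbles left at the vertex). -/
structure PebbleAgent (s p : ℕ) where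
  start : Fin s
  halt : Finset (Fin s)
  trans : Fin s → ℕ → ℕ → Finset (Fin p) → Finset (Fin p) →
      Fin s × Option ℕ × Finset (Fin p) × Finset (Fin p)

/-- A configuration of a pebble agent: state, position, port number of the edge
leading back to the previously visited vertex, and the locations of the pebbles
(`none` meaning the pebble is carried by the agent). -/
structure PConfig (V : Type) (s p : ℕ) where
  st : Fin s
  pos : V
  lab : ℕ
  peb : Fin p → Option V

variable {V : Type}

/-- One step of a pebble agent.  An agent in a halting state stays put forever. -/
def pebStep {s p : ℕ} (A : PebbleAgent s p) (G : PGraph V) (c : PConfig V s p) :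
    PConfig V s p :=
  if c.st ∈ A.halt then c
  else
    let PA : Finset (Fin p) := Finset.univ.filter (fun j => c.peb j = none)
    let Pv : Finset (Fin p) := Finset.univ.filter (fun j => c.peb j = some c.pos)
    let out := A.trans c.st (G.deg c.pos) c.lab PA Pv
    let peb' : Fin p → Option V := fun j =>
      if j ∈ out.2.2.1 then none else if j ∈ out.2.2.2 then some c.pos else c.peb j
    (match out.2.1 with
    | none => ⟨out.1, c.pos, c.lab, peb'⟩
    | some l =>
        if l < G.deg c.pos then ⟨out.1, G.nbr c.pos l, G.back c.pos l, peb'⟩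
        else ⟨out.1, c.pos, c.lab, peb'⟩)

/-- The run of a pebble agent started at `v0`, carrying all its pebbles. -/
def pebRun {s p : ℕ} (A : PebbleAgent s p) (G : PGraph V) (v0 : V) (t : ℕ) :
    PConfig V s p :=
  (pebStep A G)^[t] ⟨A.start, v0, 0, fun _ => none⟩

/-- The agent explores `G` from `v0` if it eventually visits every vertex. -/
def pebExplores {s p : ℕ} (A : PebbleAgent s p) (G : PGraph V) (v0 : V) : Prop :=
  ∀ w : V, ∃ t, (pebRun A G v0 t).pos = w

/-- Number of edge traversals performed by the agent during the first `N` steps. -/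
def pebTrav {s p : ℕ} (A : PebbleAgent s p) (G : PGraph V) (v0 : V) (N : ℕ) : ℕ :=
  ((Finset.range N).filter
    (fun t => (pebRun A G v0 (t + 1)).pos ≠ (pebRun A G v0 t).pos)).card

/-! ### Pebble walks on an abelian group -/

namespace PebbleWalk

/-- Configurations of a walker with state `st` and pebbles `P` on a group `Γ`; a pebble
located at `none` is carried. -/
structure Conf (Q Γ P : Type) where
  st : Q
  pos : Γ
  peb : P → Option Γ

variable {Q Γ P : Type} [AddCommGroup Γ] {S S' : Finset P} {c c' : Conf Q Γ P}

/-- The configuration as seen by the walker: its state and the positions of the pebbles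
in `S` relative to its own. -/
def view (S : Finset P) (c : Conf Q Γ P) : Q × (P → Option (Option Γ)) :=
  (c.st, fun j => if j ∈ S then some ((c.peb j).map (· - c.pos)) else none)

theorem st_eq_of_view_eq (h : view S c = view S' c') : c.st = c'.st :=
  congrArg Prod.fst h

theorem finset_eq_of_view_eq (h : view S c = view S' c') : S = S' := by
  ext j
  have := congrFun (congrArg Prod.snd h) j
  by_cases h1 : j ∈ S <;> by_cases h2 : j ∈ S' <;> simp [view, h1, h2] at this ⊢

theorem peb_map_eq_of_view_eq (h : view S c = view S c') {j : P} (hj : j ∈ S) :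
    (c.peb j).map (· - c.pos) = (c'.peb j).map (· - c'.pos) := by
  have := congrFun (congrArg Prod.snd h) j
  simpa [view, hj] using this

theorem eq_of_view_eq (h : view S c = view S c') (hpos : c.pos = c'.pos)
    (hS : ∀ j ∉ S, c.peb j = c'.peb j) : c = c' := by
  have hst := st_eq_of_view_eq h
  have hpeb : c.peb = c'.peb := by
    funext j
    by_cases hj : j ∈ S
    · have := peb_map_eq_of_view_eq h hj
      rw [← hpos] at this
      exact Option.map_injective (sub_left_injective (b := c.pos)) this
    · exact hS j hj
  cases c
  cases c'
  simp_all

variable [Fintype P]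

/-- The pebbles carried by the walker. -/
def carried (c : Conf Q Γ P) : Finset P := Finset.univ.filter (fun j => c.peb j = none)

/-- The pebbles lying at the position of the walker. -/
def here (c : Conf Q Γ P) : Finset P := Finset.univ.filter (fun j => c.peb j = some c.pos)

/-- One step of the walker: `δ` yields the new state, the displacement, the pebbles carried
and the pebbles left behind. -/
def step (δ : Q → Finset P → Finset P → Q × Γ × Finset P × Finset P) (c : Conf Q Γ P) :
    Conf Q Γ P :=
  let out := δ c.st (carried c) (here c)
  ⟨out.1, c.pos + out.2.1, fun j =>
    if j ∈ out.2.2.1 then none else if j ∈ out.2.2.2 then some c.pos else c.peb j⟩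

/-- The pebbles observed or moved in the next step. -/
def active (δ : Q → Finset P → Finset P → Q × Γ × Finset P × Finset P) (c : Conf Q Γ P) :
    Finset P :=
  let out := δ c.st (carried c) (here c)
  carried c ∪ here c ∪ out.2.2.1 ∪ out.2.2.2

/-- The pebbles observed or moved in the next `t` steps. -/
def touched (δ : Q → Finset P → Finset P → Q × Γ × Finset P × Finset P) (c : Conf Q Γ P)
    (t : ℕ) : Finset P :=
  (Finset.range t).biUnion (fun i => active δ ((step δ)^[i] c))

variable {δ : Q → Finset P → Finset P → Q × Γ × Finset P × Finset P}

theorem view_step_eq (h : view S c = view S c') (hc : carried c = carried c')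
    (hh : here c = here c') :
    view (S ∪ active δ c) (step δ c) = view (S ∪ active δ c') (step δ c') ∧
      (step δ c).pos - c.pos = (step δ c').pos - c'.pos := by
  have hst := st_eq_of_view_eq h
  have hact : active δ c = active δ c' := by simp [active, hst, hc, hh]
  have hout : δ c.st (carried c) (here c) = δ c'.st (carried c') (here c') := by
    rw [hst, hc, hh]
  refine ⟨?_, by simp [step, hout]⟩
  rw [← hact]
  refine Prod.ext (by simp [view, step, hout]) ?_
  funext j
  simp only [view]
  by_cases hj : j ∈ S ∪ active δ c
  swap
  · simp [hj]
  simp only [hj, if_true, step, hout]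
  by_cases h1 : j ∈ (δ c'.st (carried c') (here c')).2.2.1
  · simp [h1]
  by_cases h2 : j ∈ (δ c'.st (carried c') (here c')).2.2.2
  · simp [h1, h2]
  simp only [h1, h2, if_false]
  congr 1
  by_cases h3 : j ∈ carried c
  · have h4 : j ∈ carried c' := hc ▸ h3
    simp only [carried, Finset.mem_filter, Finset.mem_univ, true_and] at h3 h4
    simp [h3, h4]
  by_cases h5 : j ∈ here c
  · have h6 : j ∈ here c' := hh ▸ h5
    simp only [here, Finset.mem_filter, Finset.mem_univ, true_and] at h5 h6
    simp [h5, h6]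
  have hS : j ∈ S := by
    simp only [active, Finset.mem_union, hout] at hj
    tauto
  have := congrArg (Option.map (· - (δ c'.st (carried c') (here c')).2.1))
    (peb_map_eq_of_view_eq h hS)
  simpa [Option.map_map, Function.comp_def, sub_sub] using this

theorem carried_eq_of_view_eq (h : view S c = view S c') (hS : active δ c ⊆ S)
    (hS' : active δ c' ⊆ S) : carried c = carried c' := by
  ext j
  by_cases hj : j ∈ S
  · have := peb_map_eq_of_view_eq h hj
    simp only [carried, Finset.mem_filter, Finset.mem_univ, true_and]
    rw [← Option.map_eq_none_iff (f := (· - c.pos)), this, Option.map_eq_none_iff]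
  · have h1 : j ∉ active δ c := fun h => hj (hS h)
    have h2 : j ∉ active δ c' := fun h => hj (hS' h)
    simp only [active, Finset.mem_union] at h1 h2
    tauto

theorem here_eq_of_view_eq (h : view S c = view S c') (hS : active δ c ⊆ S)
    (hS' : active δ c' ⊆ S) : here c = here c' := by
  have key : ∀ (d : Conf Q Γ P) (j : P),
      j ∈ here d ↔ (d.peb j).map (· - d.pos) = some 0 := by
    intro d j
    simp [here, sub_eq_zero]
  ext j
  by_cases hj : j ∈ S
  · rw [key, key, peb_map_eq_of_view_eq h hj]
  · have h1 : j ∉ active δ c := fun h => hj (hS h)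
    have h2 : j ∉ active δ c' := fun h => hj (hS' h)
    simp only [active, Finset.mem_union] at h1 h2
    tauto

theorem touched_zero : touched δ c 0 = ∅ := by simp [touched]

theorem touched_succ (t : ℕ) :
    touched δ c (t + 1) = touched δ c t ∪ active δ ((step δ)^[t] c) := by
  simp [touched, Finset.range_add_one, Finset.union_comm]

theorem touched_mono {t u : ℕ} (h : t ≤ u) : touched δ c t ⊆ touched δ c u :=
  Finset.biUnion_subset_biUnion_of_subset_left _ (Finset.range_mono h)

theorem touched_iterate_subset {i t u : ℕ} (h : i + t ≤ u) :
    touched δ ((step δ)^[i] c) t ⊆ touched δ c u := by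
  intro j hj
  simp only [touched, Finset.mem_biUnion, Finset.mem_range] at hj ⊢
  obtain ⟨a, ha, hj⟩ := hj
  exact ⟨a + i, by omega, by rwa [Function.iterate_add_apply]⟩

theorem view_iterate_eq (h : view S c = view S c') (t : ℕ) (ht : touched δ c t ⊆ S)
    (ht' : touched δ c' t ⊆ S) :
    view S ((step δ)^[t] c) = view S ((step δ)^[t] c') ∧
      ((step δ)^[t] c).pos - c.pos = ((step δ)^[t] c').pos - c'.pos := by
  induction t with
  | zero => simpa using h
  | succ t ih =>
    rw [touched_succ, Finset.union_subset_iff] at ht ht'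
    obtain ⟨ih1, ih2⟩ := ih ht.1 ht'.1
    have := view_step_eq (δ := δ) ih1 (carried_eq_of_view_eq ih1 ht.2 ht'.2)
      (here_eq_of_view_eq ih1 ht.2 ht'.2)
    rw [Finset.union_eq_left.2 ht.2, Finset.union_eq_left.2 ht'.2] at this
    simp only [Function.iterate_succ_apply']
    refine ⟨this.1, ?_⟩
    have := congrArg₂ (· + ·) this.2 ih2
    simpa using this

theorem peb_iterate_eq {t : ℕ} {j : P} (hj : j ∉ touched δ c t) :
    ((step δ)^[t] c).peb j = c.peb j := by
  induction t with
  | zero => rfl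
  | succ t ih =>
    rw [touched_succ, Finset.mem_union, not_or] at hj
    rw [Function.iterate_succ_apply', ← ih hj.1]
    have := hj.2
    simp only [active, Finset.mem_union, not_or] at this
    simp [step, this]

/-- In a group of exponent two a walk that repeats its view returns after twice the time. -/
theorem iterate_two_mul_eq (hΓ : ∀ g : Γ, g + g = 0) {t : ℕ}
    (h : view S c = view S ((step δ)^[t] c)) (ht : touched δ c (2 * t) ⊆ S) :
    (step δ)^[2 * t] c = c := by
  have h1 := view_iterate_eq h t ((touched_mono (by omega)).trans ht)
    ((touched_iterate_subset (by omega)).trans ht)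
  rw [← Function.iterate_add_apply, ← two_mul] at h1
  refine (eq_of_view_eq (h.trans h1.1) ?_ fun j hj => ?_).symm
  · have h2 := hΓ (((step δ)^[t] c).pos - c.pos)
    nth_rewrite 1 [h1.2] at h2
    rw [sub_add_sub_cancel, sub_eq_zero] at h2
    exact h2.symm
  · exact (peb_iterate_eq fun h => hj (ht h)).symm

theorem not_injOn_of_card_le (hΓ : ∀ g : Γ, g + g = 0) {t K : ℕ} (ht : touched δ c t ⊆ S)
    {X : Finset (Q × (P → Option (Option Γ)))} (hX : X.card ≤ K) {τ : ℕ → ℕ}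
    (hτ : StrictMonoOn τ (Set.Iic K)) (hτX : ∀ i ≤ K, view S ((step δ)^[τ i] c) ∈ X)
    (hK : 2 * τ K ≤ t) : ¬ Set.InjOn (fun i => (step δ)^[i] c) (Set.Iic t) := by
  intro hinj
  obtain ⟨i, hi, k, hk, hne, heq⟩ := Finset.exists_ne_map_eq_of_card_lt_of_maps_to
    (s := Finset.range (K + 1)) (t := X) (by simpa using Nat.lt_succ_of_le hX)
    (f := fun i => view S ((step δ)^[τ i] c))
    (fun i hi => hτX i (Nat.lt_succ_iff.1 (Finset.mem_range.1 hi)))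
  wlog hlt : i < k generalizing i k
  · exact this k hk i hi hne.symm heq.symm (by omega)
  simp only [Finset.mem_range, Nat.lt_succ_iff] at hi hk
  have h1 : τ i < τ k := hτ hi hk hlt
  have h2 : τ k ≤ τ K := hτ.monotoneOn hk (Set.mem_Iic.2 le_rfl) hk
  have h3 := iterate_two_mul_eq (δ := δ) hΓ (c := (step δ)^[τ i] c) (S := S) (t := τ k - τ i)
    (by rw [← Function.iterate_add_apply, Nat.sub_add_cancel h1.le]; exact heq)
    ((touched_iterate_subset (by omega)).trans ht)
  rw [← Function.iterate_add_apply] at h3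
  have := hinj (Set.mem_Iic.2 (by omega)) (Set.mem_Iic.2 (by omega)) h3
  omega

theorem exists_card_touched_le {r t : ℕ} (h : r < (touched δ c t).card) :
    ∃ u < t, (touched δ c u).card ≤ r ∧ r < (touched δ c (u + 1)).card := by
  induction t with
  | zero => simp [touched_zero] at h
  | succ t ih =>
    by_cases h' : r < (touched δ c t).card
    · obtain ⟨u, hu, h1⟩ := ih h'
      exact ⟨u, by omega, h1⟩
    · exact ⟨t, by omega, by omega, h⟩

variable [Fintype Q] [Fintype Γ]

/-- The views after an injective run touching at most `r` pebbles. -/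
def views (δ : Q → Finset P → Finset P → Q × Γ × Finset P × Finset P) (r : ℕ) :
    Finset (Q × (P → Option (Option Γ))) :=
  Finset.univ.filter fun x => ∃ (c : Conf Q Γ P) (t : ℕ),
    x = view (touched δ c t) ((step δ)^[t] c) ∧ (touched δ c t).card ≤ r ∧
      Set.InjOn (fun i => (step δ)^[i] c) (Set.Iic t)

/-- The views one step after an injective run touching at most `r` pebbles. -/
def freshViews (δ : Q → Finset P → Finset P → Q × Γ × Finset P × Finset P) (r : ℕ) :
    Finset (Q × (P → Option (Option Γ))) :=
  Finset.univ.filter fun x => ∃ (c : Conf Q Γ P) (t : ℕ),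
    x = view (touched δ c (t + 1)) ((step δ)^[t + 1] c) ∧ (touched δ c t).card ≤ r ∧
      Set.InjOn (fun i => (step δ)^[i] c) (Set.Iic t)

theorem card_freshViews_le (r : ℕ) :
    (freshViews δ r).card ≤ 4 ^ Fintype.card P * (views δ r).card := by
  have hex : ∀ x : freshViews δ r, ∃ (c : Conf Q Γ P) (t : ℕ),
      x = view (touched δ c (t + 1)) ((step δ)^[t + 1] c) ∧ (touched δ c t).card ≤ r ∧
        Set.InjOn (fun i => (step δ)^[i] c) (Set.Iic t) := fun x =>
    (Finset.mem_filter.1 x.2).2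
  choose c t hx hcard hinj using hex
  have h := Fintype.card_le_of_injective
    (β := views δ r × (Finset P × Finset P))
    (fun x : freshViews δ r =>
      (⟨view (touched δ (c x) (t x)) ((step δ)^[t x] (c x)),
        Finset.mem_filter.2 ⟨Finset.mem_univ _, c x, t x, rfl, hcard x, hinj x⟩⟩,
        carried ((step δ)^[t x] (c x)), here ((step δ)^[t x] (c x))))
    (by
      intro x y hxy
      simp only [Prod.mk.injEq] at hxy
      obtain ⟨h1, h2, h3⟩ := hxy
      replace h1 := congrArg Subtype.val h1
      simp only at h1
      have hS := finset_eq_of_view_eq h1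
      rw [hS] at h1
      have := (view_step_eq (δ := δ) h1 h2 h3).1
      refine Subtype.ext ?_
      rw [hx x, hx y, touched_succ, touched_succ, Function.iterate_succ_apply',
        Function.iterate_succ_apply', hS, this])
  simp only [Fintype.card_coe, Fintype.card_prod, Fintype.card_finset] at h
  calc _ ≤ _ := h
    _ = _ := by rw [← mul_pow]; norm_num [mul_comm]

theorem card_views_succ_le {r Z : ℕ}
    (hZ : ∀ (c : Conf Q Γ P) (t : ℕ), (touched δ c t).card ≤ r + 1 →
      Set.InjOn (fun i => (step δ)^[i] c) (Set.Iic t) → t < Z) :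
    (views δ (r + 1)).card ≤ (views δ r).card + (freshViews δ r).card * Z := by
  have hex : ∀ x : ↥(views δ (r + 1) \ views δ r), ∃ (c : Conf Q Γ P) (S : Finset P) (t : ℕ),
      x = view S ((step δ)^[t] c) ∧ view S c ∈ freshViews δ r ∧ touched δ c t ⊆ S ∧ t < Z := by
    rintro ⟨x, hx⟩
    rw [Finset.mem_sdiff] at hx
    obtain ⟨c, t, rfl, hcard, hinj⟩ := (Finset.mem_filter.1 hx.1).2
    have hr : r < (touched δ c t).card := by
      by_contra hr
      exact hx.2 (Finset.mem_filter.2 ⟨Finset.mem_univ _, c, t, rfl, by omega, hinj⟩)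
    obtain ⟨u, hu, hu1, hu2⟩ := exists_card_touched_le hr
    have hS : touched δ c (u + 1) = touched δ c t :=
      Finset.eq_of_subset_of_card_le (touched_mono hu) (by omega)
    refine ⟨(step δ)^[u + 1] c, touched δ c t, t - (u + 1), ?_, ?_, ?_, ?_⟩
    · rw [← Function.iterate_add_apply, Nat.sub_add_cancel hu]
    · rw [← hS]
      exact Finset.mem_filter.2 ⟨Finset.mem_univ _, c, u, rfl, hu1,
        hinj.mono (Set.Iic_subset_Iic.2 hu.le)⟩
    · exact touched_iterate_subset (by omega)
    · have := hZ c t hcard hinj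
      omega
  choose c S t hx hfresh htouched ht using hex
  have h := Fintype.card_le_of_injective (β := freshViews δ r × Fin Z)
    (fun x : ↥(views δ (r + 1) \ views δ r) => (⟨view (S x) (c x), hfresh x⟩, ⟨t x, ht x⟩))
    (by
      intro x y hxy
      simp only [Prod.mk.injEq, Subtype.mk.injEq, Fin.mk.injEq] at hxy
      obtain ⟨h1, h2⟩ := hxy
      have hS := finset_eq_of_view_eq h1
      rw [hS] at h1
      refine Subtype.ext ?_
      rw [hx x, hx y, h2, hS]
      exact (view_iterate_eq h1 (t y) (hS ▸ h2 ▸ htouched x) (htouched y)).1)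
  simp only [Fintype.card_coe, Fintype.card_prod, Fintype.card_fin] at h
  have := Finset.card_le_card_sdiff_add_card (s := views δ (r + 1)) (t := views δ r)
  omega

theorem lt_of_injOn_succ (hΓ : ∀ g : Γ, g + g = 0) {r Z : ℕ}
    (hZ : ∀ (c : Conf Q Γ P) (t : ℕ), (touched δ c t).card ≤ r →
      Set.InjOn (fun i => (step δ)^[i] c) (Set.Iic t) → t < Z)
    (c : Conf Q Γ P) (t : ℕ) (hc : (touched δ c t).card ≤ r + 1)
    (hinj : Set.InjOn (fun i => (step δ)^[i] c) (Set.Iic t)) :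
    t < 2 * (((freshViews δ r).card + 1) * Z) := by
  by_contra! hlt
  set K := (freshViews δ r).card
  have hle : ∀ i ≤ K, (i + 1) * Z ≤ t := fun i hi => by
    have := Nat.mul_le_mul_right Z (Nat.succ_le_succ hi)
    simp only [Nat.succ_eq_add_one] at this
    omega
  have hex : ∀ i, ∃ u, i ≤ K → u < Z ∧
      view (touched δ c t) ((step δ)^[i * Z + u + 1] c) ∈ freshViews δ r := by
    intro i
    by_cases hi : i ≤ K
    swap
    · exact ⟨0, fun h => absurd h hi⟩
    have hiZ := hle i hi
    rw [add_mul, one_mul] at hiZ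
    have hinj' : ∀ u ≤ Z, Set.InjOn (fun k => (step δ)^[k] ((step δ)^[i * Z] c)) (Set.Iic u) := by
      intro u hu a ha b hb hab
      simp only [← Function.iterate_add_apply] at hab
      have := hinj (Set.mem_Iic.2 (by simp at ha; omega)) (Set.mem_Iic.2 (by simp at hb; omega)) hab
      omega
    have hr : r < (touched δ ((step δ)^[i * Z] c) Z).card := by
      by_contra! h
      exact lt_irrefl _ (hZ _ _ h (hinj' Z le_rfl))
    obtain ⟨u, hu, hu1, hu2⟩ := exists_card_touched_le hr
    have hS : touched δ ((step δ)^[i * Z] c) (u + 1) = touched δ c t :=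
      Finset.eq_of_subset_of_card_le (touched_iterate_subset (by omega)) (by omega)
    refine ⟨u, fun _ => ⟨hu, Finset.mem_filter.2 ⟨Finset.mem_univ _, (step δ)^[i * Z] c, u, ?_,
      hu1, hinj' u hu.le⟩⟩⟩
    rw [hS, ← Function.iterate_add_apply]
    congr 2
    ring_nf
  choose u hu using hex
  refine not_injOn_of_card_le (τ := fun i => i * Z + u i + 1) (K := K) hΓ subset_rfl le_rfl ?_
    (fun i hi => (hu i hi).2) ?_ hinj
  · intro i hi k hk hik
    have h1 := (hu i hi).1
    have h2 := Nat.mul_le_mul_right Z (Nat.succ_le_of_lt hik)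
    simp only [Nat.succ_eq_add_one, add_mul, one_mul] at h2
    simp only
    omega
  · have h1 := (hu K le_rfl).1
    rw [add_mul, one_mul] at hlt
    omega

/-- An injective run has at most doubly exponential length in the number of touched pebbles. -/
theorem card_views_le_and_lt_of_injOn [Nonempty Q] (hΓ : ∀ g : Γ, g + g = 0) (r : ℕ) :
    (views δ r).card ≤ (4 ^ (Fintype.card P + 1) * Fintype.card Q) ^ 8 ^ r ∧
    ∀ (c : Conf Q Γ P) (t : ℕ), (touched δ c t).card ≤ r →
      Set.InjOn (fun i => (step δ)^[i] c) (Set.Iic t) →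
        t < (4 ^ (Fintype.card P + 1) * Fintype.card Q) ^ 8 ^ r := by
  have hQ : 0 < Fintype.card Q := Fintype.card_pos
  have hP : 0 < 4 ^ Fintype.card P := by positivity
  induction r with
  | zero =>
    let X : Finset (Q × (P → Option (Option Γ))) := Finset.univ.image fun q : Q => (q, fun _ => none)
    have hX : X.card ≤ Fintype.card Q := Finset.card_image_le
    have hview : ∀ c : Conf Q Γ P, view ∅ c ∈ X := fun c =>
      Finset.mem_image.2 ⟨c.st, Finset.mem_univ _, by simp [view]⟩
    have hM : 2 * Fintype.card Q < 4 ^ (Fintype.card P + 1) * Fintype.card Q := by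
      rw [pow_succ]
      nlinarith
    rw [pow_zero, pow_one]
    refine ⟨?_, fun c t hc hinj => ?_⟩
    · refine (Finset.card_le_card (t := X) fun x hx => ?_).trans (by omega)
      obtain ⟨c, t, rfl, hc, -⟩ := (Finset.mem_filter.1 hx).2
      rw [Finset.card_eq_zero.1 (Nat.le_zero.1 hc)]
      exact hview _
    · by_contra! hlt
      exact not_injOn_of_card_le (τ := id) (K := Fintype.card Q) (S := ∅) hΓ
        (Finset.card_eq_zero.1 (Nat.le_zero.1 hc)).subset hX
        (strictMono_id.strictMonoOn _) (fun i _ => hview _) (by simp only [id]; omega) hinj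
  | succ r ih =>
    set Z := (4 ^ (Fintype.card P + 1) * Fintype.card Q) ^ 8 ^ r with hZdef
    have hbase : 4 ^ (Fintype.card P + 1) ≤ Z :=
      (Nat.le_mul_of_pos_right _ hQ).trans (Nat.le_self_pow (by positivity) _)
    have hZ4 : 4 * 4 ^ Fintype.card P ≤ Z := by rwa [pow_succ, mul_comm] at hbase
    have h4 : 4 ≤ Z := by omega
    have hZ8 : (4 ^ (Fintype.card P + 1) * Fintype.card Q) ^ 8 ^ (r + 1) = Z ^ 8 := by
      rw [hZdef, ← pow_mul, ← pow_succ]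
    rw [hZ8]
    have hfresh : (freshViews δ r).card ≤ Z ^ 2 := by
      refine (card_freshViews_le r).trans ?_
      rw [sq]
      exact Nat.mul_le_mul (by omega) ih.1
    have hrun : ∀ (c : Conf Q Γ P) (t : ℕ), (touched δ c t).card ≤ r + 1 →
        Set.InjOn (fun i => (step δ)^[i] c) (Set.Iic t) → t < Z ^ 4 := by
      intro c t hc hinj
      refine (lt_of_injOn_succ hΓ ih.2 c t hc hinj).trans_le ?_
      calc 2 * (((freshViews δ r).card + 1) * Z) ≤ 2 * ((Z ^ 2 + 1) * Z) := by gcongr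
        _ ≤ Z ^ 4 := by nlinarith [Nat.mul_le_mul_right (Z ^ 3) h4, sq_nonneg Z, pow_succ Z 3]
    refine ⟨?_, fun c t hc hinj =>
      (hrun c t hc hinj).trans_le (Nat.pow_le_pow_right (by omega) (by norm_num))⟩
    calc (views δ (r + 1)).card ≤ (views δ r).card + (freshViews δ r).card * Z ^ 4 :=
          card_views_succ_le hrun
      _ ≤ Z + Z ^ 2 * Z ^ 4 := by gcongr; exact ih.1
      _ ≤ Z ^ 6 + Z ^ 6 := by
          rw [← pow_add]
          gcongr
          exact Nat.le_self_pow (by norm_num) Z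
      _ ≤ Z * Z ^ 6 := by
          rw [← two_mul]
          gcongr
          omega
      _ = Z ^ 7 := by ring
      _ ≤ Z ^ 8 := Nat.pow_le_pow_right (by omega) (by norm_num)

theorem exists_iterate_lt_of_eq {α : Type*} {f : α → α} {x : α} {i j : ℕ} (hij : i < j)
    (h : f^[i] x = f^[j] x) (t : ℕ) : ∃ u < j, f^[u] x = f^[t] x := by
  induction t with
  | zero => exact ⟨0, by omega, rfl⟩
  | succ t ih =>
    obtain ⟨u, hu, hut⟩ := ih
    rcases (Nat.succ_le_of_lt hu).lt_or_eq with h1 | h1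
    · exact ⟨u + 1, h1, by rw [Function.iterate_succ_apply', hut, Function.iterate_succ_apply']⟩
    · refine ⟨i, hij, ?_⟩
      rw [h, ← h1, Nat.succ_eq_add_one, Function.iterate_succ_apply', hut,
        Function.iterate_succ_apply']

/-- A walk with pebbles visiting a whole group of exponent two bounds the size of the group. -/
theorem card_le_of_forall_exists_pos_eq [Nonempty Q] (hΓ : ∀ g : Γ, g + g = 0)
    (c : Conf Q Γ P) (h : ∀ g : Γ, ∃ t, ((step δ)^[t] c).pos = g) :
    Fintype.card Γ ≤ (4 ^ (Fintype.card P + 1) * Fintype.card Q) ^ 8 ^ Fintype.card P := by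
  set Z := (4 ^ (Fintype.card P + 1) * Fintype.card Q) ^ 8 ^ Fintype.card P
  have hinj : ¬ Set.InjOn (fun i => (step δ)^[i] c) (Set.Iic Z) := fun hinj =>
    lt_irrefl _ ((card_views_le_and_lt_of_injOn hΓ (Fintype.card P)).2 c Z
      (Finset.card_le_univ _) hinj)
  simp only [Set.InjOn, not_forall] at hinj
  obtain ⟨i, hi, j, hj, hij, hne⟩ := hinj
  wlog hlt : i < j generalizing i j
  · exact this j hj i hi hij.symm (Ne.symm hne) (by omega)
  have hsub : (Finset.univ : Finset Γ) ⊆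
      (Finset.range j).image fun t => ((step δ)^[t] c).pos := by
    intro g _
    obtain ⟨t, rfl⟩ := h g
    obtain ⟨u, hu, hut⟩ := exists_iterate_lt_of_eq hlt hij t
    exact Finset.mem_image.2 ⟨u, Finset.mem_range.2 hu, by rw [hut]⟩
  calc Fintype.card Γ ≤ _ := Finset.card_le_card hsub
    _ ≤ (Finset.range j).card := Finset.card_image_le
    _ = j := Finset.card_range j
    _ ≤ Z := hj

end PebbleWalk

/-! ### The hypercube as a trap -/

/-- The `d`-dimensional hypercube, whose vertices are named through `e` and whose edges carry
the flipped coordinate as port number at both endpoints. -/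
def hypercube {d : ℕ} (e : V ≃ (Fin d → ZMod 2)) : PGraph V where
  deg _ := d
  nbr v i := if h : i < d then e.symm (e v + Pi.single ⟨i, h⟩ 1) else v
  back _ i := i

theorem add_self_eq_zero_of_zmod_two {d : ℕ} (g : Fin d → ZMod 2) : g + g = 0 :=
  funext fun _ => CharTwo.add_self_eq_zero _

theorem hypercube_wf {d : ℕ} (hd : 0 < d) (e : V ≃ (Fin d → ZMod 2)) : (hypercube e).Wf := by
  refine ⟨fun _ => hd, fun _ _ hi => hi, fun v i hi => ?_, fun _ _ _ => rfl, fun v i hi => ?_,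
    fun v i hi j hj h => ?_⟩
  · have hi : i < d := hi
    simp [hypercube, hi, add_assoc, add_self_eq_zero_of_zmod_two]
  · have hi : i < d := hi
    simp [hypercube, hi, Equiv.symm_apply_eq]
  · have hi : i < d := hi
    have hj : j < d := hj
    simp only [hypercube, hi, hj, dif_pos, EmbeddingLike.apply_eq_iff_eq, add_right_inj] at h
    have := congrFun h ⟨i, hi⟩
    by_contra hne
    simp [hne] at this

theorem hypercube_conn {d : ℕ} (e : V ≃ (Fin d → ZMod 2)) : (hypercube e).Conn := by
  intro a b
  have key : ∀ S : Finset (Fin d), Relation.ReflTransGen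
      (fun x y => ∃ i, i < (hypercube e).deg x ∧ (hypercube e).nbr x i = y) a
      (e.symm (e a + ∑ i ∈ S, Pi.single i ((e b - e a) i))) := by
    intro S
    induction S using Finset.induction_on with
    | empty => simpa using Relation.ReflTransGen.refl
    | insert i S hi ih =>
      rw [Finset.sum_insert hi]
      rcases (by decide : ∀ z : ZMod 2, z = 0 ∨ z = 1) ((e b - e a) i) with h | h
      · simpa [h] using ih
      · refine ih.tail ⟨i, i.2, ?_⟩
        rw [h]
        simp only [hypercube, i.2, dif_pos, Equiv.apply_symm_apply, EmbeddingLike.apply_eq_iff_eq]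
        abel
  have := key Finset.univ
  rwa [Finset.univ_sum_single, add_sub_cancel, Equiv.symm_apply_apply] at this

/-- The transition function of a pebble agent on the `d`-dimensional hypercube, with the
entry port stored in the state. -/
def cubeTrans {s p d : ℕ} (A : PebbleAgent s p) (q : Fin s × Fin d) (PA Pv : Finset (Fin p)) :
    (Fin s × Fin d) × (Fin d → ZMod 2) × Finset (Fin p) × Finset (Fin p) :=
  if q.1 ∈ A.halt then (q, 0, PA, Pv)
  else
    let out := A.trans q.1 d q.2 PA Pv
    match out.2.1 with
    | none => ((out.1, q.2), 0, out.2.2)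
    | some l =>
      if h : l < d then ((out.1, ⟨l, h⟩), Pi.single ⟨l, h⟩ 1, out.2.2)
      else ((out.1, q.2), 0, out.2.2)

/-- The configuration on the hypercube described by a configuration on the group. -/
def toPConfig {s p d : ℕ} (e : V ≃ (Fin d → ZMod 2))
    (c : PebbleWalk.Conf (Fin s × Fin d) (Fin d → ZMod 2) (Fin p)) : PConfig V s p :=
  ⟨c.st.1, e.symm c.pos, c.st.2, fun j => (c.peb j).map e.symm⟩

theorem toPConfig_step {s p d : ℕ} (A : PebbleAgent s p) (e : V ≃ (Fin d → ZMod 2))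
    (c : PebbleWalk.Conf (Fin s × Fin d) (Fin d → ZMod 2) (Fin p)) :
    toPConfig e (PebbleWalk.step (cubeTrans A) c) = pebStep A (hypercube e) (toPConfig e c) := by
  have hPA : Finset.univ.filter (fun j => (toPConfig e c).peb j = none) =
      PebbleWalk.carried c := by
    ext j
    simp [toPConfig, PebbleWalk.carried]
  have hPv : Finset.univ.filter (fun j => (toPConfig e c).peb j = some (toPConfig e c).pos) =
      PebbleWalk.here c := by
    ext j
    simp [toPConfig, PebbleWalk.here]
  unfold pebStep
  simp only [hPA, hPv]
  have hst : (toPConfig e c).st = c.st.1 := rfl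
  have hlab : (toPConfig e c).lab = c.st.2 := rfl
  have hdeg : ∀ v, (hypercube e).deg v = d := fun _ => rfl
  have hpeb : ∀ (C L : Finset (Fin p)),
      (fun j => (if j ∈ C then none else if j ∈ L then some c.pos else c.peb j).map e.symm) =
      (fun j => if j ∈ C then none else if j ∈ L then some (toPConfig e c).pos
        else (toPConfig e c).peb j) := by
    intro C L
    funext j
    split_ifs <;> rfl
  by_cases hh : c.st.1 ∈ A.halt
  · simp only [hst, hh, if_true]
    simp only [PebbleWalk.step, cubeTrans, hh, if_true, toPConfig, add_zero, PConfig.mk.injEq,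
      true_and]
    funext j
    congr 1
    split_ifs with h1 h2
    · simpa [PebbleWalk.carried, eq_comm] using h1
    · simpa [PebbleWalk.here, eq_comm] using h2
    · rfl
  · simp only [hst, hh, if_false, hdeg, hlab, ← hpeb]
    simp only [PebbleWalk.step, cubeTrans, hh, if_false]
    rcases hm : (A.trans c.st.1 d c.st.2 (PebbleWalk.carried c) (PebbleWalk.here c)).2.1
      with _ | l
    · simp [toPConfig]
    · by_cases hl : l < d
      · simp [toPConfig, hl, hypercube]
      · simp [toPConfig, hl]

/-- An agent exploring the hypercube needs many states or pebbles. -/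
theorem two_pow_le_of_pebExplores {s p d : ℕ} (hd : 0 < d) (A : PebbleAgent s p)
    (e : V ≃ (Fin d → ZMod 2)) (v0 : V) (h : pebExplores A (hypercube e) v0) :
    2 ^ d ≤ (4 ^ (p + 1) * (s * d)) ^ 8 ^ p := by
  have hne : Nonempty (Fin s × Fin d) := ⟨(A.start, ⟨0, hd⟩)⟩
  have hrun : ∀ t, pebRun A (hypercube e) v0 t = toPConfig e
      ((PebbleWalk.step (cubeTrans A))^[t] ⟨(A.start, ⟨0, hd⟩), e v0, fun _ => none⟩) := by
    intro t
    rw [(Function.Semiconj.iterate_right (f := toPConfig e)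
      (fun c => toPConfig_step A e c) t).eq]
    simp [pebRun, toPConfig]
  have := PebbleWalk.card_le_of_forall_exists_pos_eq (δ := cubeTrans (d := d) A)
    add_self_eq_zero_of_zmod_two ⟨(A.start, ⟨0, hd⟩), e v0, fun _ => none⟩ (fun g => by
      obtain ⟨t, ht⟩ := h (e.symm g)
      rw [hrun] at ht
      exact ⟨t, e.symm.injective ht⟩)
  simpa [ZMod.card] using this

/-! ### Asymptotics -/

open Filter Asymptotics in
theorem eventually_rpow_mul_log_add_le {ε : ℝ} (hε : 0 < ε) (hε1 : ε < 1) (a b : ℝ) :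
    ∀ᶠ x : ℝ in atTop, x ^ (ε / 2) * (a * Real.log x + 2 + b * x ^ (1 - ε)) + 1 < x := by
  have h1 : (fun x : ℝ => a * Real.log x + 2) =o[atTop] fun x : ℝ => x ^ (1 - ε) :=
    ((isLittleO_log_rpow_atTop (sub_pos.2 hε1)).const_mul_left a).add
      (isLittleO_const_left.2 (Or.inr (tendsto_norm_atTop_atTop.comp
        (tendsto_rpow_atTop (sub_pos.2 hε1)))))
  have h2 : (fun x : ℝ => (1 + b) * x ^ (1 - ε / 2) + 1) =o[atTop] fun x : ℝ => x := by
    refine IsLittleO.add (IsLittleO.const_mul_left ?_ _)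
      (isLittleO_const_left.2 (Or.inr (tendsto_norm_atTop_atTop.comp tendsto_id)))
    refine isLittleO_of_tendsto' ((eventually_gt_atTop 0).mono fun x hx h => absurd h hx.ne')
      ((tendsto_rpow_neg_atTop (half_pos hε)).congr' ?_)
    filter_upwards [eventually_gt_atTop 0] with x hx
    rw [eq_div_iff hx.ne', ← Real.rpow_add_one hx.ne']
    ring_nf
  filter_upwards [h1.bound one_pos, h2.bound (show (0 : ℝ) < 1 / 2 by norm_num),
    eventually_gt_atTop 0] with x hx1 hx2 hx
  have hpos : 0 < x ^ (ε / 2) := Real.rpow_pos_of_pos hx _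
  rw [one_mul, Real.norm_of_nonneg (r := x ^ (1 - ε)) (Real.rpow_nonneg hx.le _)] at hx1
  rw [Real.norm_of_nonneg hx.le] at hx2
  calc _ ≤ x ^ (ε / 2) * (x ^ (1 - ε) + b * x ^ (1 - ε)) + 1 := by
        gcongr
        exact (le_abs_self _).trans hx1
    _ = (1 + b) * x ^ (1 - ε / 2) + 1 := by
        rw [show 1 - ε / 2 = ε / 2 + (1 - ε) by ring, Real.rpow_add hx]
        ring
    _ ≤ 1 / 2 * x := (le_abs_self _).trans hx2
    _ < x := by linarith

/-- For every `0 < ε < 1` and every constant `c` there is a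
constant `c' > 0` such that for all sufficiently large `n`: if a single agent
with at most `2^(c·(log n)^(1-ε))` states and `p` distinguishable pebbles
explores every connected graph on at most `n` vertices (from every starting
vertex), then `p ≥ c'·log log n`. -/
theorem lower_bound_pebbles :
    ∀ ε : ℝ, 0 < ε → ε < 1 → ∀ c : ℕ, 0 < c →
      ∃ c' : ℝ, 0 < c' ∧ ∃ N : ℕ, ∀ n : ℕ, N ≤ n →
        ∀ (s p : ℕ) (A : PebbleAgent s p),
          ((s : ℝ) ≤ (2 : ℝ) ^ ((c : ℝ) * Real.logb 2 (n : ℝ) ^ ((1 : ℝ) - ε))) →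
          (∀ m : ℕ, 0 < m → m ≤ n → ∀ G : PGraph (Fin m), G.Wf → G.Conn →
            ∀ v0 : Fin m, pebExplores A G v0) →
          c' * Real.log (Real.log (n : ℝ)) ≤ (p : ℝ) := by
  intro ε hε hε1 c _
  have hlog2 : 0 < Real.log 2 := Real.log_pos (by norm_num)
  have hlog8 : 0 < Real.log 8 := Real.log_pos (by norm_num)
  set c' : ℝ := ε / (2 * Real.log 8) with hc'
  have hc'pos : 0 < c' := by positivity
  have hlogb : Filter.Tendsto (fun n : ℕ => Real.logb 2 n) Filter.atTop Filter.atTop :=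
    (Real.tendsto_logb_atTop (by norm_num)).comp tendsto_natCast_atTop_atTop
  obtain ⟨N, hN⟩ := Filter.eventually_atTop.1 ((hlogb.eventually
    (eventually_rpow_mul_log_add_le hε hε1 (2 * c' + 1 / Real.log 2) c)).and
      ((hlogb.eventually_gt_atTop 1).and (Filter.eventually_ge_atTop 2)))
  refine ⟨c', hc'pos, N, fun n hn s p A hs hexp => ?_⟩
  obtain ⟨hbig, hL1, hn2⟩ := hN n hn
  set L := Real.logb 2 n with hL
  by_contra! hp
  have hLpos : 0 < L := by linarith
  have hlogn : Real.log n = L * Real.log 2 := by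
    rw [hL, Real.logb, div_mul_cancel₀ _ hlog2.ne']
  set d := Nat.log 2 n with hd
  have hdpos : 0 < d := Nat.log_pos (by norm_num) hn2
  have hdn : 2 ^ d ≤ n := Nat.pow_log_le_self 2 (by omega)
  have hdL : (d : ℝ) ≤ L := by
    rw [hL, Real.le_logb_iff_rpow_le (by norm_num) (by positivity), Real.rpow_natCast]
    exact_mod_cast hdn
  have hLd : L < d + 1 := by
    rw [hL, Real.logb_lt_iff_lt_rpow (by norm_num) (by positivity)]
    exact_mod_cast Nat.lt_pow_succ_log_self (b := 2) (by norm_num) n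
  let e : Fin (2 ^ d) ≃ (Fin d → ZMod 2) :=
    (Fintype.equivFinOfCardEq (by simp [ZMod.card])).symm
  have hspos : 0 < s := A.start.pos
  have hpow := two_pow_le_of_pebExplores hdpos A e ⟨0, by positivity⟩
    (hexp _ (by positivity) hdn _ (hypercube_wf hdpos e) (hypercube_conn e) _)
  have hlogpow : d * Real.log 2 ≤
      8 ^ p * ((p + 1) * (2 * Real.log 2) + (Real.log s + Real.log d)) := by
    have h := Real.log_le_log (by positivity) (Nat.cast_le (α := ℝ).2 hpow)
    have h4 : Real.log 4 = 2 * Real.log 2 := by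
      rw [show (4 : ℝ) = 2 ^ 2 by norm_num, Real.log_pow]
      norm_num
    push_cast at h
    rwa [Real.log_pow, Real.log_pow, Real.log_mul (by positivity) (by positivity), Real.log_pow,
      Real.log_mul (by positivity) (by positivity), h4, Nat.cast_pow, Nat.cast_ofNat,
      Nat.cast_add_one] at h
  have hlogs : Real.log s ≤ c * L ^ (1 - ε) * Real.log 2 := by
    rw [← Real.log_rpow (by norm_num)]
    exact Real.log_le_log (by positivity) hs
  have hlogd : Real.log d ≤ Real.log L := Real.log_le_log (by positivity) hdL
  have hpL : p ≤ c' * Real.log L := by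
    refine hp.le.trans (mul_le_mul_of_nonneg_left (Real.log_le_log ?_ ?_) hc'pos.le)
    · rw [hlogn]
      positivity
    · rw [hlogn]
      nlinarith [Real.log_two_lt_d9]
  have h8 : (8 : ℝ) ^ p ≤ L ^ (ε / 2) := by
    rw [← Real.rpow_natCast, Real.rpow_def_of_pos (by norm_num), Real.rpow_def_of_pos hLpos,
      Real.exp_le_exp]
    calc Real.log 8 * p ≤ Real.log 8 * (c' * Real.log L) := by gcongr
      _ = Real.log L * (ε / 2) := by
        rw [hc']
        field_simp
  have hlogL : 0 < Real.log L := Real.log_pos hL1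
  have hfin : d * Real.log 2 ≤ (L ^ (ε / 2) *
      ((2 * c' + 1 / Real.log 2) * Real.log L + 2 + c * L ^ (1 - ε))) * Real.log 2 := by
    calc _ ≤ _ := hlogpow
      _ ≤ L ^ (ε / 2) * ((c' * Real.log L + 1) * (2 * Real.log 2) +
          (c * L ^ (1 - ε) * Real.log 2 + Real.log L)) := by gcongr
      _ = _ := by
        field_simp
        ring
  have := le_of_mul_le_mul_right hfin hlog2
  linarith
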